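/- arXiv:2010.04619 — 2 statements merged into one kernel-verified Lean document; each statement's English description precedes it below -/
import Mathlib

section
/- Let ε ∈ [0,1) and T ∈ B(H), and let I denote the identity operator on H. If T ⊥ε_ω I, then I ⊥ε_ω T. -/
open Filter Topology
open scoped InnerProductSpace

variable {H : Type*} [NormedAddCommGroup H] [InnerProductSpace ℂ H] [CompleteSpace H]

/-- The numerical radius of a bounded operator `T`:
`ω(T) = sup {|⟨Tx, x⟩| : ‖x‖ = 1}`. -/
noncomputable def nrad (T : H →L[ℂ] H) : ℝ :=
  sSup {r : ℝ | ∃ x : H, ‖x‖ = 1 ∧ r = ‖⟪x, T x⟫_ℂ‖}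

/-- Approximate numerical-radius (Birkhoff) orthogonality:
`T ⊥ε_ω S` iff `ω(T + λS)² ≥ ω(T)² − 2ε ω(T) ω(λS)` for all `λ ∈ ℂ`. -/
def NradOrth (ε : ℝ) (T S : H →L[ℂ] H) : Prop :=
  ∀ μ : ℂ, nrad T ^ 2 - 2 * ε * nrad T * nrad (μ • S) ≤ nrad (T + μ • S) ^ 2

theorem norm_inner_le_nrad (T : H →L[ℂ] H) {x : H} (hx : ‖x‖ = 1) :
    ‖⟪x, T x⟫_ℂ‖ ≤ nrad T := by
  refine le_csSup ⟨‖T‖, ?_⟩ ⟨x, hx, rfl⟩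
  rintro r ⟨y, hy, rfl⟩
  calc ‖⟪y, T y⟫_ℂ‖ ≤ ‖y‖ * ‖T y‖ := norm_inner_le_norm _ _
    _ ≤ ‖y‖ * (‖T‖ * ‖y‖) := by gcongr; exact T.le_opNorm y
    _ = ‖T‖ := by rw [hy]; ring

theorem nrad_nonneg (T : H →L[ℂ] H) : 0 ≤ nrad T := by
  refine Real.sSup_nonneg ?_
  rintro r ⟨y, -, rfl⟩
  exact norm_nonneg _

theorem nrad_le (T : H →L[ℂ] H) {c : ℝ} (hc : 0 ≤ c)
    (h : ∀ x : H, ‖x‖ = 1 → ‖⟪x, T x⟫_ℂ‖ ≤ c) : nrad T ≤ c := by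
  refine Real.sSup_le ?_ hc
  rintro r ⟨y, hy, rfl⟩
  exact h y hy

theorem nrad_eq_zero_of_subsingleton [Subsingleton H] (T : H →L[ℂ] H) : nrad T = 0 :=
  le_antisymm (nrad_le T le_rfl fun x _ => by simp [Subsingleton.elim x 0]) (nrad_nonneg T)

theorem nrad_one [Nontrivial H] : nrad (1 : H →L[ℂ] H) = 1 := by
  have key : ∀ x : H, ‖x‖ = 1 → ‖⟪x, (1 : H →L[ℂ] H) x⟫_ℂ‖ = 1 := fun x hx => by
    simp [hx]
  obtain ⟨x, hx⟩ := exists_norm_eq H (zero_le_one (α := ℝ))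
  exact le_antisymm (nrad_le _ zero_le_one fun y hy => (key y hy).le)
    ((key x hx).symm.le.trans (norm_inner_le_nrad _ hx))

theorem nrad_smul_le (μ : ℂ) (T : H →L[ℂ] H) : nrad (μ • T) ≤ ‖μ‖ * nrad T := by
  refine nrad_le _ (mul_nonneg (norm_nonneg _) (nrad_nonneg T)) fun x hx => ?_
  have := norm_inner_le_nrad T hx
  simp only [smul_apply, inner_smul_right, norm_mul]
  gcongr

theorem nrad_smul (μ : ℂ) (T : H →L[ℂ] H) : nrad (μ • T) = ‖μ‖ * nrad T := by
  refine le_antisymm (nrad_smul_le μ T) ?_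
  rcases eq_or_ne μ 0 with rfl | hμ
  · simpa using nrad_nonneg (0 : H →L[ℂ] H)
  · have h := nrad_smul_le μ⁻¹ (μ • T)
    rw [smul_smul, inv_mul_cancel₀ hμ, one_smul, norm_inv] at h
    have hpos : 0 < ‖μ‖ := norm_pos_iff.mpr hμ
    calc ‖μ‖ * nrad T ≤ ‖μ‖ * (‖μ‖⁻¹ * nrad (μ • T)) := by gcongr
      _ = nrad (μ • T) := by field_simp

theorem exists_nrad_sq_sub_le [Nontrivial H] (T : H →L[ℂ] H) {δ : ℝ} (hδ : 0 < δ) :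
    ∃ x : H, ‖x‖ = 1 ∧ nrad T ^ 2 - δ ≤ ‖⟪x, T x⟫_ℂ‖ ^ 2 := by
  by_contra! hcon
  obtain ⟨x, hx⟩ := exists_norm_eq H (zero_le_one (α := ℝ))
  have hpos : 0 ≤ nrad T ^ 2 - δ := (sq_nonneg _).trans (hcon x hx).le
  have hle : nrad T ≤ √(nrad T ^ 2 - δ) :=
    nrad_le T (Real.sqrt_nonneg _) fun y hy => Real.le_sqrt_of_sq_le (hcon y hy).le
  have := (Real.le_sqrt (nrad_nonneg T) hpos).mp hle
  linarith

theorem NradOrth.exists_re_ge [Nontrivial H] {ε : ℝ} {T : H →L[ℂ] H}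
    (h : NradOrth ε T (1 : H →L[ℂ] H)) (μ : ℂ) {δ : ℝ} (hδ : 0 < δ) :
    ∃ x : H, ‖x‖ = 1 ∧ -(2 * ε * (‖μ‖ * nrad T)) - δ ≤ 2 * (μ * ⟪x, T x⟫_ℂ).re := by
  have hA : 0 < 1 + ‖μ‖ ^ 2 := by positivity
  obtain ⟨t, ht, htδ⟩ : ∃ t : ℝ, 0 < t ∧ t * (1 + ‖μ‖ ^ 2) = δ :=
    ⟨δ / (1 + ‖μ‖ ^ 2), by positivity, by field_simp⟩
  obtain ⟨x, hx, hxt⟩ := exists_nrad_sq_sub_le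
    (T + ((t : ℂ) * (starRingEnd ℂ) μ) • (1 : H →L[ℂ] H)) (pow_pos ht 2)
  refine ⟨x, hx, ?_⟩
  have h1 := h ((t : ℂ) * (starRingEnd ℂ) μ)
  have hz : ‖⟪x, T x⟫_ℂ‖ ^ 2 ≤ nrad T ^ 2 := by
    gcongr
    exact norm_inner_le_nrad T hx
  have hexp : ⟪x, (T + ((t : ℂ) * (starRingEnd ℂ) μ) • (1 : H →L[ℂ] H)) x⟫_ℂ
      = ⟪x, T x⟫_ℂ + (t : ℂ) * (starRingEnd ℂ) μ := by
    simp [hx]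
  have hsq : ‖⟪x, T x⟫_ℂ + (t : ℂ) * (starRingEnd ℂ) μ‖ ^ 2
      = ‖⟪x, T x⟫_ℂ‖ ^ 2 + 2 * t * (μ * ⟪x, T x⟫_ℂ).re + t ^ 2 * ‖μ‖ ^ 2 := by
    simp only [Complex.sq_norm, Complex.normSq_apply, Complex.add_re, Complex.add_im,
      Complex.mul_re, Complex.mul_im, Complex.ofReal_re, Complex.ofReal_im, Complex.conj_re,
      Complex.conj_im]
    ring
  rw [hexp, hsq] at hxt
  rw [nrad_smul, nrad_one, norm_mul, Complex.norm_real, RCLike.norm_conj, Real.norm_of_nonneg ht.le]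
    at h1
  rw [← htδ]
  refine le_of_mul_le_mul_left ?_ ht
  linarith

/-- If `T ⊥ε_ω I`, then `I ⊥ε_ω T`. -/
theorem nradOrth_id_symm (ε : ℝ) (hε0 : 0 ≤ ε) (hε1 : ε < 1) (T : H →L[ℂ] H)
    (h : NradOrth ε T (1 : H →L[ℂ] H)) :
    NradOrth ε (1 : H →L[ℂ] H) T := by
  rcases subsingleton_or_nontrivial H with hH | hH
  · intro μ
    simp [nrad_eq_zero_of_subsingleton]
  intro μ
  rw [nrad_one, nrad_smul]
  refine le_of_forall_pos_le_add fun δ hδ => ?_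
  obtain ⟨x, hx, hre⟩ := h.exists_re_ge μ hδ
  have hle : ‖⟪x, ((1 : H →L[ℂ] H) + μ • T) x⟫_ℂ‖ ^ 2 ≤ nrad (1 + μ • T) ^ 2 := by
    gcongr
    exact norm_inner_le_nrad _ hx
  have hexp : ⟪x, ((1 : H →L[ℂ] H) + μ • T) x⟫_ℂ = 1 + μ * ⟪x, T x⟫_ℂ := by
    simp [hx]
  have hsq : 1 + 2 * (μ * ⟪x, T x⟫_ℂ).re ≤ ‖1 + μ * ⟪x, T x⟫_ℂ‖ ^ 2 := by
    rw [Complex.sq_norm, Complex.normSq_apply, Complex.add_re, Complex.one_re]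
    nlinarith [mul_self_nonneg (μ * ⟪x, T x⟫_ℂ).re,
      mul_self_nonneg (1 + μ * ⟪x, T x⟫_ℂ).im]
  rw [hexp] at hle
  linarith
end

section
/- Let T, S ∈ B(H) with ω(T) ≠ 0 and let θ ∈ [0, 2π). Then lim_{r→0⁺} (ω(T + r e^{iθ} S) − ω(T))/r exists and equals D^θ_ω(T, S)/ω(T). -/
open Filter Topology
open scoped InnerProductSpace

variable {H : Type*} [NormedAddCommGroup H] [InnerProductSpace ℂ H] [CompleteSpace H]

theorem nrad_nonneg_s13 {E : Type*} [NormedAddCommGroup E] [InnerProductSpace ℂ E] (T : E →L[ℂ] E) :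
    0 ≤ nrad T := by
  refine Real.sSup_nonneg ?_
  rintro r ⟨x, -, rfl⟩
  exact norm_nonneg _

/-- A one-sided derivative of `f ^ 2 / 2` at `0` yields one of `f`, when `f` is nonnegative and its
base value `a` is positive. -/
theorem tendsto_sub_div_of_tendsto_sq_sub_sq_div {f : ℝ → ℝ} {a D : ℝ} (hf : ∀ r, 0 ≤ f r)
    (ha : 0 < a)
    (hD : Tendsto (fun r => (f r ^ 2 - a ^ 2) / (2 * r)) (𝓝[>] (0 : ℝ)) (𝓝 D)) :
    Tendsto (fun r => (f r - a) / r) (𝓝[>] (0 : ℝ)) (𝓝 (D / a)) := by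
  have hr : Tendsto (fun r : ℝ => 2 * r) (𝓝[>] (0 : ℝ)) (𝓝 0) := by
    have h : Tendsto (fun r : ℝ => 2 * r) (𝓝 0) (𝓝 (2 * 0)) := tendsto_id.const_mul 2
    rw [mul_zero] at h
    exact h.mono_left nhdsWithin_le_nhds
  have hsq : Tendsto (fun r => f r ^ 2) (𝓝[>] (0 : ℝ)) (𝓝 (a ^ 2)) := by
    have h := (hD.mul hr).add_const (a ^ 2)
    rw [mul_zero, zero_add] at h
    refine h.congr' ?_
    filter_upwards [self_mem_nhdsWithin] with r (hr0 : 0 < r)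
    field_simp
    ring
  have hlim : Tendsto f (𝓝[>] (0 : ℝ)) (𝓝 a) := by
    simpa [Real.sqrt_sq (hf _), Real.sqrt_sq ha.le] using hsq.sqrt
  have h := hD.mul ((tendsto_const_nhds (x := (2 : ℝ))).div (hlim.add_const a) (by positivity))
  have hval : D * (2 / (a + a)) = D / a := by
    field_simp
    ring
  rw [hval] at h
  refine h.congr' ?_
  filter_upwards [self_mem_nhdsWithin] with r (hr0 : 0 < r)
  simp only [Pi.div_apply]
  have hne : f r + a ≠ 0 := (add_pos_of_nonneg_of_pos (hf r) ha).ne'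
  field_simp
  ring

/-- If `ω(T) ≠ 0`, then `lim_{r→0⁺} (ω(T + r e^{iθ} S) − ω(T))/r`
exists and equals `D^θ_ω(T, S)/ω(T)`. -/
theorem nrad_first_order_deriv (T S : H →L[ℂ] H) (hT : nrad T ≠ 0) (θ : ℝ)
    (hθ : θ ∈ Set.Ico (0 : ℝ) (2 * Real.pi)) (D : ℝ)
    (hD : Tendsto
      (fun r : ℝ =>
        (nrad (T + ((r : ℂ) * Complex.exp ((θ : ℂ) * Complex.I)) • S) ^ 2 - nrad T ^ 2) /
          (2 * r))
      (𝓝[>] (0 : ℝ)) (𝓝 D)) :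
    Tendsto
      (fun r : ℝ =>
        (nrad (T + ((r : ℂ) * Complex.exp ((θ : ℂ) * Complex.I)) • S) - nrad T) / r)
      (𝓝[>] (0 : ℝ)) (𝓝 (D / nrad T)) := by
  exact tendsto_sub_div_of_tendsto_sq_sub_sq_div (fun _ => nrad_nonneg_s13 _)
    ((nrad_nonneg_s13 T).lt_of_ne' hT) hD
end
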